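/- Let n ≥ 1 and let m be a positive integer. Then, as an identity of rational functions in ℚ(x_1^{1/2},…,x_n^{1/2}), the difference of the Schur polynomials s_{(m^n)} minus s_{(m^{n−1})}, both evaluated at the 2n variables (x_1, x_1^{−1}, …, x_n, x_n^{−1}), equals sp_{((m/2−1)^n)}(x_1,…,x_n) · so^D_{((m/2+1)^n)}(x_1,…,x_n). -/

import Mathlib

open Matrix BigOperators
open scoped Classical

noncomputable section

/-- The field `ℚ(t_1, …, t_n)` of rational functions in `n` indeterminates over `ℚ`. -/
abbrev FF (n : ℕ) : Type := FractionRing (MvPolynomial (Fin n) ℚ)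

/-- The `i`-th indeterminate, viewed as an element of `FF n`. -/
def gen (n : ℕ) (i : Fin n) : FF n :=
  algebraMap (MvPolynomial (Fin n) ℚ) (FF n) (MvPolynomial.X i)

variable {F : Type*} [Field F]

/-- Symplectic character `sp_λ(x_1, …, x_N)`, in "doubled" form: `z i` represents
`x_i^{1/2}` and `μ i` represents `2·λ_i` (so half-integer weights are allowed). -/
def spD {N : ℕ} (z : Fin N → F) (μ : Fin N → ℤ) : F :=
  Matrix.det (Matrix.of fun i j : Fin N =>
      z j ^ (μ i + 2 * ((N : ℤ) - (i : ℕ))) - z j ^ (-(μ i + 2 * ((N : ℤ) - (i : ℕ))))) /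
  Matrix.det (Matrix.of fun i j : Fin N =>
      z j ^ (2 * ((N : ℤ) - (i : ℕ))) - z j ^ (-(2 * ((N : ℤ) - (i : ℕ)))))

/-- Odd orthogonal character `so^B_λ(x_1, …, x_N)`, in "doubled" form: `z i` represents
`x_i^{1/2}` and `μ i` represents `2·λ_i`. -/
def soBD {N : ℕ} (z : Fin N → F) (μ : Fin N → ℤ) : F :=
  Matrix.det (Matrix.of fun i j : Fin N =>
      z j ^ (μ i + 2 * ((N : ℤ) - (i : ℕ)) - 1) -
        z j ^ (-(μ i + 2 * ((N : ℤ) - (i : ℕ)) - 1))) /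
  Matrix.det (Matrix.of fun i j : Fin N =>
      z j ^ (2 * ((N : ℤ) - (i : ℕ)) - 1) - z j ^ (-(2 * ((N : ℤ) - (i : ℕ)) - 1)))

/-- Even orthogonal character `so^D_λ(x_1, …, x_N)`, in "doubled" form: `z i` represents
`x_i^{1/2}` and `μ i` represents `2·λ_i`; the factor is `2` if `λ_N > 0` and `1` otherwise. -/
def soDD {N : ℕ} (z : Fin N → F) (μ : Fin N → ℤ) : F :=
  (if h : 0 < N then (if 0 < μ ⟨N - 1, Nat.sub_lt h Nat.one_pos⟩ then (2 : F) else 1) else 1) *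
  (Matrix.det (Matrix.of fun i j : Fin N =>
      z j ^ (μ i + 2 * ((N : ℤ) - 1 - (i : ℕ))) +
        z j ^ (-(μ i + 2 * ((N : ℤ) - 1 - (i : ℕ))))) /
   Matrix.det (Matrix.of fun i j : Fin N =>
      z j ^ (2 * ((N : ℤ) - 1 - (i : ℕ))) + z j ^ (-(2 * ((N : ℤ) - 1 - (i : ℕ))))))

/-- The matrix `Ā_λ` of the bialternant formula for the intermediate symplectic character
`sp^{(k, N-k)}`, in "doubled" form: `z i` represents `x_i^{1/2}`, `μ i` represents `2·λ_i`. -/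
def interMatD {N : ℕ} (k : ℕ) (z : Fin N → F) (μ : Fin N → ℤ) : Matrix (Fin N) (Fin N) F :=
  Matrix.of fun i j : Fin N =>
    if (j : ℕ) < k then
      z j ^ (μ i + 2 * ((k : ℤ) - (i : ℕ))) /
          ∏ l ∈ Finset.univ.filter (fun l : Fin N => k ≤ (l : ℕ)), (1 - (z j ^ 2)⁻¹ * z l ^ 2) -
        z j ^ (-(μ i + 2 * ((k : ℤ) - (i : ℕ)))) /
          ∏ l ∈ Finset.univ.filter (fun l : Fin N => k ≤ (l : ℕ)), (1 - z j ^ 2 * z l ^ 2)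
    else z j ^ (μ i + 2 * ((N : ℤ) - 1 - (i : ℕ)))

/-- Intermediate symplectic character `sp^{(k, N-k)}_λ(x_1, …, x_k | x_{k+1}, …, x_N)`, in
"doubled" form: `z i` represents `x_i^{1/2}` and `μ i` represents `2·λ_i`. -/
def spInterD {N : ℕ} (k : ℕ) (z : Fin N → F) (μ : Fin N → ℤ) : F :=
  (interMatD k z μ).det / (interMatD k z fun _ => 0).det

/-- Symplectic character `sp_λ(z_1, …, z_N)` for an integer weight `μ`. -/
def spP {N : ℕ} (z : Fin N → F) (μ : Fin N → ℤ) : F :=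
  Matrix.det (Matrix.of fun i j : Fin N =>
      z j ^ (μ i + (N : ℤ) - (i : ℕ)) - z j ^ (-(μ i + (N : ℤ) - (i : ℕ)))) /
  Matrix.det (Matrix.of fun i j : Fin N =>
      z j ^ ((N : ℤ) - (i : ℕ)) - z j ^ (-((N : ℤ) - (i : ℕ))))

/-- The matrix `Ā_λ` of the bialternant formula for the intermediate symplectic character
`sp^{(k, N-k)}` with integer weight `μ`. -/
def interMatP {N : ℕ} (k : ℕ) (z : Fin N → F) (μ : Fin N → ℤ) : Matrix (Fin N) (Fin N) F :=
  Matrix.of fun i j : Fin N =>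
    if (j : ℕ) < k then
      z j ^ (μ i + (k : ℤ) - (i : ℕ)) /
          ∏ l ∈ Finset.univ.filter (fun l : Fin N => k ≤ (l : ℕ)), (1 - (z j)⁻¹ * z l) -
        z j ^ (-(μ i + (k : ℤ) - (i : ℕ))) /
          ∏ l ∈ Finset.univ.filter (fun l : Fin N => k ≤ (l : ℕ)), (1 - z j * z l)
    else z j ^ (μ i + (N : ℤ) - 1 - (i : ℕ))

/-- Intermediate symplectic character `sp^{(k, N-k)}_μ(z_1, …, z_k | z_{k+1}, …, z_N)`
for an integer weight `μ`. -/
def spInterP {N : ℕ} (k : ℕ) (z : Fin N → F) (μ : Fin N → ℤ) : F :=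
  (interMatP k z μ).det / (interMatP k z fun _ => 0).det

/-- Schur function `s_μ(z_1, …, z_N)` as a ratio of alternants (bialternant formula). -/
def schurP {N : ℕ} (z : Fin N → F) (μ : Fin N → ℤ) : F :=
  Matrix.det (Matrix.of fun i j : Fin N => z j ^ (μ i + (N : ℤ) - 1 - (i : ℕ))) /
  Matrix.det (Matrix.of fun i j : Fin N => z j ^ ((N : ℤ) - 1 - (i : ℕ)))

section Alternants

variable {n : ℕ} {z : Fin n → F}

/-- Rows of `Fin (2 * n)`: the top half in order, the bottom half reversed. -/
def foldEquiv (n : ℕ) : Fin n ⊕ Fin n ≃ Fin (2 * n) where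
  toFun := Sum.elim (fun i => ⟨i, by omega⟩) (fun i => ⟨2 * n - 1 - i, by omega⟩)
  invFun k := if h : (k : ℕ) < n then Sum.inl ⟨k, h⟩ else Sum.inr ⟨2 * n - 1 - k, by omega⟩
  left_inv := by
    rintro (i | i)
    · simp
    · have := i.isLt
      have h : ¬ 2 * n - 1 - (i : ℕ) < n := by omega
      exact (dif_neg h).trans (congrArg Sum.inr (Fin.ext (by simp only [Sum.elim_inr]; omega)))
  right_inv k := by
    have := k.isLt
    by_cases h : (k : ℕ) < n
    · simp [h]
    · simp only [h, dite_false, Sum.elim_inr, Fin.ext_iff]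
      omega

/-- Columns of `Fin (2 * n)`: the even ones, then the odd ones. -/
def interleaveEquiv (n : ℕ) : Fin n ⊕ Fin n ≃ Fin (2 * n) where
  toFun := Sum.elim (fun j => ⟨2 * j, by omega⟩) (fun j => ⟨2 * j + 1, by omega⟩)
  invFun k := if (k : ℕ) % 2 = 0 then Sum.inl ⟨k / 2, by omega⟩ else Sum.inr ⟨k / 2, by omega⟩
  left_inv := by
    rintro (j | j)
    · simp
    · have h : (2 * (j : ℕ) + 1) % 2 = 1 := by omega
      have h' : (2 * (j : ℕ) + 1) / 2 = j := by omega
      simp [h, h']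
  right_inv k := by
    by_cases h : (k : ℕ) % 2 = 0
    · simp only [h, if_true, Sum.elim_inl, Fin.ext_iff]
      omega
    · simp only [h, if_false, Sum.elim_inr, Fin.ext_iff]
      omega

theorem exists_det_submatrix_equiv {α β : Type*} [Fintype α] [DecidableEq α] [Fintype β]
    [DecidableEq β] (e f : α ≃ β) :
    ∃ ε : F, ε ≠ 0 ∧ ∀ M : Matrix β β F, (M.submatrix e f).det = ε * M.det := by
  refine ⟨((Equiv.Perm.sign (f.symm.trans e) : ℤ) : F), ?_, fun M => ?_⟩
  · rcases Int.units_eq_one_or (Equiv.Perm.sign (f.symm.trans e)) with h | h <;> simp [h]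
  · rw [← Matrix.det_permute, ← Matrix.det_submatrix_equiv_self f]
    congr 1
    ext i j
    simp

theorem det_zpow_add {ι : Type*} [Fintype ι] [DecidableEq ι] {w : ι → F} (hw : ∀ j, w j ≠ 0)
    (hw1 : ∏ j, w j = 1) (s : ℤ) (p : ι → ℤ) :
    (Matrix.of fun i j => w j ^ (p i + s)).det = (Matrix.of fun i j => w j ^ p i).det := by
  have := Matrix.det_mul_row (fun j => w j ^ s) (Matrix.of fun i j => w j ^ p i)
  rw [Finset.prod_zpow, hw1, _root_.one_zpow, one_mul] at this
  rw [← this]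
  congr 1
  ext i j
  simp [zpow_add₀ (hw j), mul_comm]

/-- The superdiagonal shift matrix. -/
def superShift (F : Type*) [Field F] (n : ℕ) : Matrix (Fin n) (Fin n) F :=
  Matrix.of fun i j => if (j : ℕ) = i + 1 then 1 else 0

theorem superShift_mul_apply (Q : Matrix (Fin n) (Fin n) F) (i j : Fin n) :
    (superShift F n * Q) i j = if h : (i : ℕ) + 1 < n then Q ⟨i + 1, h⟩ j else 0 := by
  rw [Matrix.mul_apply]
  split_ifs with h
  · rw [Finset.sum_eq_single ⟨i + 1, h⟩]
    · simp [superShift]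
    · intro b _ hb
      have : (b : ℕ) ≠ i + 1 := fun hc => hb (Fin.ext hc)
      simp [superShift, this]
    · simp
  · refine Finset.sum_eq_zero fun b _ => ?_
    have := b.isLt
    have : (b : ℕ) ≠ i + 1 := by omega
    simp [superShift, this]

theorem det_fromBlocks_antisymm (P P' Q Q' K : Matrix (Fin n) (Fin n) F)
    (h : P' + K * Q' = -(P + K * Q)) :
    (Matrix.fromBlocks P P' Q Q').det = (P + K * Q).det * (Q + Q').det := by
  have key : Matrix.fromBlocks 1 K 0 1 * Matrix.fromBlocks P P' Q Q' * Matrix.fromBlocks 1 1 0 1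
      = Matrix.fromBlocks (P + K * Q) 0 Q (Q + Q') := by
    simp [Matrix.fromBlocks_multiply, h]
  simpa using congrArg Matrix.det key

theorem det_fromBlocks_symm (P P' Q Q' K : Matrix (Fin n) (Fin n) F)
    (h : P' + K * Q' = P + K * Q) :
    (Matrix.fromBlocks P P' Q Q').det = (P + K * Q).det * (Q' - Q).det := by
  have key : Matrix.fromBlocks 1 K 0 1 * Matrix.fromBlocks P P' Q Q' *
      Matrix.fromBlocks 1 (-1) 0 1 = Matrix.fromBlocks (P + K * Q) 0 Q (Q' - Q) := by
    simp [Matrix.fromBlocks_multiply, h, sub_eq_neg_add]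
  simpa using congrArg Matrix.det key

theorem det_sub_det_of_row {ι : Type*} [Fintype ι] [DecidableEq ι] (A B : Matrix ι ι F) (r : ι)
    (h : ∀ i, i ≠ r → A i = B i) :
    A.det - B.det = (A.updateRow r (A r - B r)).det := by
  have hB : A.updateRow r (B r) = B := by
    ext i j
    by_cases hi : i = r
    · subst hi; simp
    · simp [hi, h i hi]
  have := Matrix.det_updateRow_add A r (A r - B r) (B r)
  rw [sub_add_cancel, Matrix.updateRow_eq_self, hB] at this
  rw [this, add_sub_cancel_right]

/-- The variables `z_1, …, z_n, z_1⁻¹, …, z_n⁻¹`. -/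
def withInv (z : Fin n → F) : Fin n ⊕ Fin n → F := Sum.elim z fun j => (z j)⁻¹

theorem withInv_ne_zero (hz : ∀ j, z j ≠ 0) (j : Fin n ⊕ Fin n) : withInv z j ≠ 0 := by
  rcases j with j | j <;> simp [withInv, hz]

theorem prod_withInv (hz : ∀ j, z j ≠ 0) : ∏ j, withInv z j = 1 := by
  rw [Fintype.prod_sum_type, ← Finset.prod_mul_distrib]
  exact Finset.prod_eq_one fun j _ => by simp [withInv, hz j]

/-- Doubled exponents of the alternant with constant weight `m` on the top rows, the last of which
gets the weight `l`, after centring by `m + 2 * n`. -/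
def foldExp (n : ℕ) (m l : ℤ) : Fin n ⊕ Fin n → ℤ :=
  Sum.elim
    (fun i => if (i : ℕ) + 1 < n then m + 2 * n - 2 - 2 * (i : ℕ) else l)
    (fun i => -(m + 2 * n - 2 * (i : ℕ)))

theorem det_foldExp_sub (hn : 1 ≤ n) (m : ℤ) :
    (Matrix.of fun i j => withInv z j ^ foldExp n m m i).det -
      (Matrix.of fun i j => withInv z j ^ foldExp n m (-m) i).det =
    (Matrix.of fun i j : Fin n =>
      z j ^ (m - 2 + 2 * ((n : ℤ) - (i : ℕ))) - z j ^ (-(m - 2 + 2 * ((n : ℤ) - (i : ℕ))))).det *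
    (Matrix.of fun i j : Fin n =>
      z j ^ (m + 2 + 2 * ((n : ℤ) - 1 - (i : ℕ))) +
        z j ^ (-(m + 2 + 2 * ((n : ℤ) - 1 - (i : ℕ))))).det := by
  have hlast : ∀ i : Fin n, ¬ (i : ℕ) + 1 < n → (i : ℕ) = n - 1 := by omega
  rw [det_sub_det_of_row _ _ (Sum.inl ⟨n - 1, by omega⟩)]
  · set S : Matrix (Fin n) (Fin n) F := Matrix.of fun i j : Fin n =>
      z j ^ (m - 2 + 2 * ((n : ℤ) - (i : ℕ))) - z j ^ (-(m - 2 + 2 * ((n : ℤ) - (i : ℕ)))) with hS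
    set P : Matrix (Fin n) (Fin n) F := Matrix.of fun i j : Fin n =>
      if (i : ℕ) + 1 < n then z j ^ (m + 2 * n - 2 - 2 * (i : ℕ)) else z j ^ m - z j ^ (-m) with hP
    set P' : Matrix (Fin n) (Fin n) F := Matrix.of fun i j : Fin n =>
      if (i : ℕ) + 1 < n then z j ^ (-(m + 2 * n - 2 - 2 * (i : ℕ)))
        else z j ^ (-m) - z j ^ m with hP'
    set Q : Matrix (Fin n) (Fin n) F := Matrix.of fun i j : Fin n =>
      z j ^ (-(m + 2 * n - 2 * (i : ℕ))) with hQ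
    set Q' : Matrix (Fin n) (Fin n) F := Matrix.of fun i j : Fin n =>
      z j ^ (m + 2 * n - 2 * (i : ℕ)) with hQ'
    have hPS : P + -superShift F n * Q = S := by
      ext i j
      rw [Matrix.neg_mul, Matrix.add_apply, Matrix.neg_apply, superShift_mul_apply]
      by_cases hi : (i : ℕ) + 1 < n
      · simp only [hP, hQ, hS, Matrix.of_apply, hi, if_true, dite_true]
        rw [← sub_eq_add_neg]
        congr 2 <;> push_cast <;> ring
      · have hi' : ((i : ℕ) : ℤ) = n - 1 := by have := hlast i hi; omega
        simp only [hP, hS, Matrix.of_apply, hi, if_false, dite_false, hi', neg_zero, add_zero]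
        congr 2 <;> ring
    have hPS' : P' + -superShift F n * Q' = -S := by
      ext i j
      rw [Matrix.neg_mul, Matrix.add_apply, Matrix.neg_apply, superShift_mul_apply,
        Matrix.neg_apply]
      by_cases hi : (i : ℕ) + 1 < n
      · simp only [hP', hQ', hS, Matrix.of_apply, hi, if_true, dite_true]
        rw [← sub_eq_add_neg, neg_sub]
        push_cast
        ring_nf
      · have hi' : ((i : ℕ) : ℤ) = n - 1 := by have := hlast i hi; omega
        simp only [hP', hS, Matrix.of_apply, hi, if_false, dite_false, hi', neg_zero, add_zero]
        rw [neg_sub]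
        congr 2 <;> ring
    have hblocks := det_fromBlocks_antisymm P P' Q Q' (-superShift F n) (by rw [hPS, hPS'])
    rw [hPS] at hblocks
    convert hblocks using 2
    · ext i j
      rcases i with i | i
      · by_cases hi : (i : ℕ) + 1 < n
        · have hne : i ≠ ⟨n - 1, by omega⟩ := by
            intro hc
            have := congrArg Fin.val hc
            simp only at this
            omega
          rcases j with j | j <;>
            simp [Matrix.updateRow_apply, hne, foldExp, hi, withInv, hP, hP', -neg_sub]
        · have hin : i = ⟨n - 1, by omega⟩ := Fin.ext (hlast i hi)
          have hn' : ¬ n - 1 + 1 < n := by omega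
          rw [hin]
          rcases j with j | j <;>
            simp [foldExp, hn', withInv, hP, hP']
      · rcases j with j | j
        · simp [Matrix.updateRow_apply, foldExp, withInv, hQ, -neg_sub]
        · simp [Matrix.updateRow_apply, foldExp, withInv, hQ', -neg_sub]
    · congr 1
      ext i j
      simp only [hQ, hQ', Matrix.add_apply, Matrix.of_apply]
      rw [add_comm]
      congr 2 <;> ring
  · rintro (i | i) hi
    · have hi' : (i : ℕ) + 1 < n := by
        by_contra hc
        exact hi (congrArg Sum.inl (Fin.ext (hlast i hc)))
      ext j
      simp [foldExp, hi']
    · ext j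
      simp [foldExp]

theorem two_mul_det_foldExp_zero (hn : 1 ≤ n) :
    2 * (Matrix.of fun i j => withInv z j ^ foldExp n 0 0 i).det =
    (Matrix.of fun i j : Fin n =>
      z j ^ (2 * ((n : ℤ) - (i : ℕ))) - z j ^ (-(2 * ((n : ℤ) - (i : ℕ))))).det *
    (Matrix.of fun i j : Fin n =>
      z j ^ (2 * ((n : ℤ) - 1 - (i : ℕ))) + z j ^ (-(2 * ((n : ℤ) - 1 - (i : ℕ))))).det := by
  have hlast : ∀ i : Fin n, ¬ (i : ℕ) + 1 < n → (i : ℕ) = n - 1 := by omega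
  set T : Matrix (Fin n) (Fin n) F := Matrix.of fun i j : Fin n =>
    z j ^ (2 * ((n : ℤ) - 1 - (i : ℕ))) + z j ^ (-(2 * ((n : ℤ) - 1 - (i : ℕ)))) with hT
  set P : Matrix (Fin n) (Fin n) F := Matrix.of fun i j : Fin n =>
    z j ^ (2 * ((n : ℤ) - 1 - (i : ℕ))) with hP
  set P' : Matrix (Fin n) (Fin n) F := Matrix.of fun i j : Fin n =>
    z j ^ (-(2 * ((n : ℤ) - 1 - (i : ℕ)))) with hP'
  set Q : Matrix (Fin n) (Fin n) F := Matrix.of fun i j : Fin n =>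
    z j ^ (-(2 * ((n : ℤ) - (i : ℕ)))) with hQ
  set Q' : Matrix (Fin n) (Fin n) F := Matrix.of fun i j : Fin n =>
    z j ^ (2 * ((n : ℤ) - (i : ℕ))) with hQ'
  set r : Fin n := ⟨n - 1, by omega⟩ with hr
  set R : Matrix (Fin n) (Fin n) F := T.updateRow r 1 with hR
  have hTR : T.det = 2 * R.det := by
    rw [hR, ← Matrix.det_updateRow_smul]
    congr 1
    ext i j
    by_cases hi : i = r
    · subst hi
      have : (((n - 1 : ℕ) : ℤ)) = n - 1 := by omega
      simp [hT, hr, this, one_add_one_eq_two]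
    · simp [hi]
  have hrow (i j : Fin n) : R i j = if (i : ℕ) + 1 < n then T i j else 1 := by
    by_cases hi : (i : ℕ) + 1 < n
    · have hne : i ≠ r := by
        intro hc
        have := congrArg Fin.val hc
        simp only [hr] at this
        omega
      simp [hR, hi, hne]
    · obtain rfl : i = r := Fin.ext (hlast i hi)
      rw [if_neg hi]
      simp [hR]
  have hPR : P + superShift F n * Q = R := by
    ext i j
    rw [Matrix.add_apply, superShift_mul_apply, hrow]
    by_cases hi : (i : ℕ) + 1 < n
    · simp only [hP, hQ, hT, Matrix.of_apply, hi, if_true, dite_true]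
      congr 2
      push_cast
      ring
    · have hi' : ((i : ℕ) : ℤ) = n - 1 := by have := hlast i hi; omega
      simp [hP, hi, hi']
  have hPR' : P' + superShift F n * Q' = R := by
    ext i j
    rw [Matrix.add_apply, superShift_mul_apply, hrow]
    by_cases hi : (i : ℕ) + 1 < n
    · simp only [hP', hQ', hT, Matrix.of_apply, hi, if_true, dite_true]
      rw [add_comm]
      congr 2
      push_cast
      ring
    · have hi' : ((i : ℕ) : ℤ) = n - 1 := by have := hlast i hi; omega
      simp [hP', hi, hi']
  have hblocks := det_fromBlocks_symm P P' Q Q' (superShift F n) (by rw [hPR, hPR'])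
  have hM : (Matrix.of fun i j => withInv z j ^ foldExp n 0 0 i) =
      Matrix.fromBlocks P P' Q Q' := by
    have hexp (i : Fin n) : foldExp n 0 0 (Sum.inl i) = 2 * ((n : ℤ) - 1 - (i : ℕ)) := by
      simp only [foldExp, Sum.elim_inl]
      split_ifs with hi
      · ring
      · have := hlast i hi
        omega
    have hexp' (i : Fin n) : foldExp n 0 0 (Sum.inr i) = -(2 * ((n : ℤ) - (i : ℕ))) := by
      simp only [foldExp, Sum.elim_inr]
      ring
    ext i j
    rcases i with i | i <;> rcases j with j | j <;>
      simp only [Matrix.of_apply, hexp, hexp', withInv, Sum.elim_inl, Sum.elim_inr,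
        Matrix.fromBlocks_apply₁₁, Matrix.fromBlocks_apply₁₂, Matrix.fromBlocks_apply₂₁,
        Matrix.fromBlocks_apply₂₂, hP, hP', hQ, hQ', _root_.inv_zpow, _root_.zpow_neg, inv_inv]
  rw [hM, hblocks, hPR, hTR, show Q' - Q = Matrix.of fun i j : Fin n =>
    z j ^ (2 * ((n : ℤ) - (i : ℕ))) - z j ^ (-(2 * ((n : ℤ) - (i : ℕ)))) from rfl]
  ring

theorem exists_det_alternant (hz : ∀ j, z j ≠ 0) (y : Fin (2 * n) → F)
    (hy : ∀ j, y (interleaveEquiv n j) = withInv z j ^ 2) :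
    ∃ ε : F, ε ≠ 0 ∧ ∀ (p : Fin (2 * n) → ℤ) (s : ℤ) (q : Fin n ⊕ Fin n → ℤ),
      (∀ i, 2 * p (foldEquiv n i) = q i + s) →
      ε * (Matrix.of fun i j => y j ^ p i).det = (Matrix.of fun i j => withInv z j ^ q i).det := by
  obtain ⟨ε, hε, h⟩ := exists_det_submatrix_equiv (F := F) (foldEquiv n) (interleaveEquiv n)
  refine ⟨ε, hε, fun p s q hq => ?_⟩
  rw [← h, ← det_zpow_add (withInv_ne_zero hz) (prod_withInv hz) s q]
  congr 1
  ext i j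
  simp only [Matrix.submatrix_apply, Matrix.of_apply, hy, ← hq, _root_.zpow_mul, zpow_ofNat]

end Alternants

theorem gen_ne_zero (n : ℕ) (i : Fin n) : gen n i ≠ 0 := by
  rw [gen, Ne, IsFractionRing.to_map_eq_zero_iff]
  exact MvPolynomial.X_ne_zero i

/-- **Factorization.**  For `n ≥ 1` and a positive integer `m`, the difference of the Schur
functions of shapes `(m^n)` and `(m^{n-1})` in the `2n` variables
`(x_1, x_1^{-1}, …, x_n, x_n^{-1})` equals
`sp_{((m/2-1)^n)}(x_1,…,x_n) · so^D_{((m/2+1)^n)}(x_1,…,x_n)`, as an identity in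
`ℚ(x_1^{1/2}, …, x_n^{1/2})`.  Here `gen n i` plays the role of `x_i^{1/2}` (so
`x_i = (gen n i)^2`), and the weights of `spD` and `soDD` are doubled. -/
theorem schur_rectangle_diff_factor_sp_soD (n m : ℕ) (hn : 1 ≤ n) (hm : 0 < m) :
    schurP
      (fun j : Fin (2 * n) =>
        if (j : ℕ) % 2 = 0 then gen n ⟨(j : ℕ) / 2, by have := j.isLt; omega⟩ ^ 2
        else (gen n ⟨(j : ℕ) / 2, by have := j.isLt; omega⟩ ^ 2)⁻¹)
      (fun j => if (j : ℕ) < n then (m : ℤ) else 0) -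
    schurP
      (fun j : Fin (2 * n) =>
        if (j : ℕ) % 2 = 0 then gen n ⟨(j : ℕ) / 2, by have := j.isLt; omega⟩ ^ 2
        else (gen n ⟨(j : ℕ) / 2, by have := j.isLt; omega⟩ ^ 2)⁻¹)
      (fun j => if (j : ℕ) < n - 1 then (m : ℤ) else 0) =
    spD (gen n) (fun _ => (m : ℤ) - 2) * soDD (gen n) (fun _ => (m : ℤ) + 2) := by
  set y : Fin (2 * n) → FF n := fun j : Fin (2 * n) =>
    if (j : ℕ) % 2 = 0 then gen n ⟨(j : ℕ) / 2, by have := j.isLt; omega⟩ ^ 2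
    else (gen n ⟨(j : ℕ) / 2, by have := j.isLt; omega⟩ ^ 2)⁻¹ with hy
  have hyw (j : Fin n ⊕ Fin n) : y (interleaveEquiv n j) = withInv (gen n) j ^ 2 := by
    rcases j with j | j
    · simp [hy, interleaveEquiv, withInv]
    · have h : (2 * (j : ℕ) + 1) % 2 = 1 := by omega
      have h' : (2 * (j : ℕ) + 1) / 2 = j := by omega
      simp [hy, interleaveEquiv, withInv, h, h']
  obtain ⟨ε, hε, hdet⟩ := exists_det_alternant (gen_ne_zero n) y hyw
  have h1 := hdet (fun i => (if (i : ℕ) < n then (m : ℤ) else 0) + ((2 * n : ℕ) : ℤ) - 1 - (i : ℕ))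
    (m + 2 * n) (foldExp n m m) (by
      rintro (i | i)
      · have := i.isLt
        simp only [foldEquiv, foldExp, Equiv.coe_fn_mk, Sum.elim_inl]
        omega
      · have := i.isLt
        simp only [foldEquiv, foldExp, Equiv.coe_fn_mk, Sum.elim_inr]
        omega)
  have h2 := hdet
    (fun i => (if (i : ℕ) < n - 1 then (m : ℤ) else 0) + ((2 * n : ℕ) : ℤ) - 1 - (i : ℕ))
    (m + 2 * n) (foldExp n m (-m)) (by
      rintro (i | i)
      · have := i.isLt
        simp only [foldEquiv, foldExp, Equiv.coe_fn_mk, Sum.elim_inl]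
        omega
      · have := i.isLt
        simp only [foldEquiv, foldExp, Equiv.coe_fn_mk, Sum.elim_inr]
        omega)
  have h0 := hdet (fun i => ((2 * n : ℕ) : ℤ) - 1 - (i : ℕ)) (2 * n) (foldExp n 0 0) (by
      rintro (i | i)
      · have := i.isLt
        simp only [foldEquiv, foldExp, Equiv.coe_fn_mk, Sum.elim_inl]
        omega
      · have := i.isLt
        simp only [foldEquiv, foldExp, Equiv.coe_fn_mk, Sum.elim_inr]
        omega)
  have hnum := det_foldExp_sub (z := gen n) hn m
  have hden := two_mul_det_foldExp_zero (z := gen n) hn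
  rw [← h1, ← h2, ← mul_sub] at hnum
  rw [← h0] at hden
  have hpos : 0 < n := hn
  have hm2 : (0 : ℤ) < (m : ℤ) + 2 := by omega
  have h2ne : (2 : FF n) ≠ 0 := two_ne_zero
  simp only [schurP, spD, soDD, hpos, hm2, dite_true, if_true]
  rw [← sub_div, ← mul_div_mul_left _ _ hε, hnum, ← mul_div_mul_left _ _ h2ne, hden, mul_left_comm,
    mul_div_mul_comm, mul_div_assoc]
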